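/- arXiv:1407.0643 — 9 statements merged into one kernel-verified Lean document; each statement's English description precedes it below -/
import Mathlib

section
/- Let H be a connected simple graph on n vertices with radius ρ_H, let α be a real number with α ≥ ρ_H, let c be a center of H (a vertex whose eccentricity in H equals ρ_H), and let T be a shortest-path spanning tree of H rooted at c (a spanning tree with d_T(c,v) = d_H(c,v) for every vertex v). Let σ be the strategy profile in which every vertex buys exactly the edges of T towards its children, i.e., σ_v = {w : w is a child of v in T rooted at c}, so that G(σ) = T. Then σ is a Nash equilibrium of the max-distance network creation game on H with parameter α. -/
open scoped ENNReal Classical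

namespace NCG

variable {V : Type*}

/-- A strategy profile is valid w.r.t. host graph `H` if each player only buys
edges of `H` incident to it. -/
def Valid (H : SimpleGraph V) (σ : V → Finset V) : Prop :=
  ∀ v, ∀ w ∈ σ v, H.Adj v w

/-- The graph created by a strategy profile: `u` and `v` are adjacent iff one
of them bought the edge towards the other. -/
def created (σ : V → Finset V) : SimpleGraph V :=
  SimpleGraph.fromRel (fun u v => v ∈ σ u)

/-- Eccentricity of a vertex (`⊤` if the graph is disconnected). -/
noncomputable def ecc (G : SimpleGraph V) (v : V) : ℕ∞ :=
  ⨆ u, G.edist v u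

/-- Radius of a graph. -/
noncomputable def radius (G : SimpleGraph V) : ℕ∞ :=
  ⨅ v, ecc G v

/-- The cost of player `v` under strategy profile `σ`, with edge price `α`:
`α` times the number of bought edges plus the eccentricity of `v` in the
created graph. -/
noncomputable def cost (α : ℝ) (σ : V → Finset V) (v : V) : ℝ≥0∞ :=
  ENNReal.ofReal α * (σ v).card + (ecc (created σ) v : ℝ≥0∞)

/-- Nash equilibrium: no player can strictly decrease its own cost by
unilaterally switching to another valid strategy. -/
def IsNE [DecidableEq V] (H : SimpleGraph V) (α : ℝ) (σ : V → Finset V) : Prop :=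
  Valid H σ ∧ ∀ v (s : Finset V), (∀ w ∈ s, H.Adj v w) →
    cost α σ v ≤ cost α (Function.update σ v s) v

/-- Social cost of a strategy profile. -/
noncomputable def SC [Fintype V] (α : ℝ) (σ : V → Finset V) : ℝ≥0∞ :=
  ∑ v, cost α σ v

end NCG

namespace SimpleGraph

variable {V : Type*}

/-- In a tree, the neighbour of a vertex that is closer to the root is unique. -/
lemma IsTree.eq_of_adj_of_dist_eq_succ {T : SimpleGraph V} (hT : T.IsTree) {c p q a : V}
    (hp : T.Adj p a) (hq : T.Adj q a) (hdp : T.dist c a = T.dist c p + 1)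
    (hdq : T.dist c a = T.dist c q + 1) : p = q := by
  obtain ⟨P, hP⟩ := hT.connected.exists_walk_length_eq_dist c p
  obtain ⟨Q, hQ⟩ := hT.connected.exists_walk_length_eq_dist c q
  have hP' : (P.concat hp).IsPath :=
    Walk.isPath_of_length_eq_dist _ (by rw [Walk.length_concat, hP, hdp])
  have hQ' : (Q.concat hq).IsPath :=
    Walk.isPath_of_length_eq_dist _ (by rw [Walk.length_concat, hQ, hdq])
  have h := congrArg Subtype.val ((hT.isAcyclic.subsingleton_path c a).elim ⟨_, hP'⟩ ⟨_, hQ'⟩)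
  exact (Walk.concat_inj h).1

/-- A set of vertices closed under adjacency is closed under reachability. -/
lemma Reachable.mem_of_mem {G : SimpleGraph V} {D : Set V}
    (hD : ∀ a b, G.Adj a b → a ∈ D → b ∈ D) {a b : V} (hab : G.Reachable a b) (ha : a ∈ D) :
    b ∈ D := by
  obtain ⟨W⟩ := hab
  induction W with
  | nil => exact ha
  | cons h _ ih => exact ih (hD _ _ h ha)

/-- In a tree rooted at `c`, if `w` lies on the geodesic from `c` to `q ≠ w`, then it also lies
on the geodesic from `c` to the parent of `q`. -/
lemma IsTree.dist_parent_eq_add {T : SimpleGraph V} (hT : T.IsTree) {c w p q : V}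
    (hpq : T.Adj p q) (hd : T.dist c q = T.dist c p + 1)
    (hq : T.dist c q = T.dist c w + T.dist w q) (hne : q ≠ w) :
    T.dist c p = T.dist c w + T.dist w p := by
  obtain ⟨P, hP⟩ := hT.connected.exists_walk_length_eq_dist q w
  cases P with
  | nil => exact absurd rfl hne
  | @cons _ r _ h P =>
    rw [Walk.length_cons, dist_comm] at hP
    have hr : T.dist w r ≤ P.length := by rw [dist_comm]; exact dist_le P
    have h₁ := hT.connected.dist_triangle (u := c) (v := w) (w := r)
    have h₂ := hT.connected.dist_triangle (u := c) (v := r) (w := q)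
    have h₃ : T.dist r q = 1 := dist_eq_one_iff_adj.2 h.symm
    obtain rfl : p = r := hT.eq_of_adj_of_dist_eq_succ hpq h.symm hd (by omega)
    omega

end SimpleGraph

namespace NCG

open SimpleGraph

variable {V : Type*}

lemma created_adj {σ : V → Finset V} {a b : V} :
    (created σ).Adj a b ↔ a ≠ b ∧ (b ∈ σ a ∨ a ∈ σ b) :=
  SimpleGraph.fromRel_adj _ _ _

lemma created_le {H : SimpleGraph V} {σ : V → Finset V} (h : Valid H σ) : created σ ≤ H := by
  intro a b hab
  rcases (created_adj.1 hab).2 with hb | ha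
  exacts [h a b hb, (h b a ha).symm]

lemma edist_le_ecc (G : SimpleGraph V) (v u : V) : G.edist v u ≤ ecc G v :=
  le_iSup (fun u => G.edist v u) u

lemma Valid.update [DecidableEq V] {H : SimpleGraph V} {σ : V → Finset V} (h : Valid H σ) {v : V}
    {s : Finset V} (hs : ∀ w ∈ s, H.Adj v w) : Valid H (Function.update σ v s) := by
  intro a b hb
  by_cases ha : a = v
  · subst ha
    exact hs b (by simpa using hb)
  · exact h a b (by simpa [ha] using hb)

/-- If every player buys the edges towards its children in a shortest-path tree, then a player that
does not buy the edge towards its child `w` is disconnected from `w`. -/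
lemma not_reachable_created_update [DecidableEq V] {H T : SimpleGraph V} (hH : H.Connected)
    (hT : T.IsTree) {c : V} (hSP : ∀ v, T.dist c v = H.dist c v) {σ : V → Finset V}
    (hσ : ∀ v w, w ∈ σ v ↔ T.Adj v w ∧ T.dist c w = T.dist c v + 1)
    {v w : V} {s : Finset V} (hs : ∀ x ∈ s, H.Adj v x) (hw : w ∈ σ v) (hws : w ∉ s) :
    ¬ (created (Function.update σ v s)).Reachable w v := by
  obtain ⟨hvw, hdw⟩ := (hσ v w).1 hw
  set D : Set V := {x | T.dist c x = T.dist c w + T.dist w x} with hD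
  have hvD : v ∉ D := fun h => by
    have h' : T.dist c v = T.dist c w + T.dist w v := h
    omega
  have hclosed : ∀ p q, q ∈ Function.update σ v s p → (p ∈ D ↔ q ∈ D) := by
    intro p q hpq
    by_cases hpv : p = v
    · subst hpv
      rw [Function.update_self] at hpq
      refine iff_of_false hvD fun hq => ?_
      have hq' : T.dist c q = T.dist c w + T.dist w q := hq
      have h₁ := hH.dist_triangle (u := c) (v := p) (w := q)
      rw [dist_eq_one_iff_adj.2 (hs q hpq), ← hSP, ← hSP] at h₁
      have h₂ : w = q := hT.connected.dist_eq_zero_iff.1 (by omega)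
      exact hws (h₂ ▸ hpq)
    · rw [Function.update_of_ne hpv] at hpq
      obtain ⟨hadj, hd⟩ := (hσ p q).1 hpq
      constructor
      · intro hp
        have hp' : T.dist c p = T.dist c w + T.dist w p := hp
        have h₁ := hT.connected.dist_triangle (u := c) (v := w) (w := q)
        have h₂ := hT.connected.dist_triangle (u := w) (v := p) (w := q)
        rw [dist_eq_one_iff_adj.2 hadj] at h₂
        change T.dist c q = T.dist c w + T.dist w q
        omega
      · intro hq
        refine hT.dist_parent_eq_add hadj hd hq ?_
        rintro rfl
        exact hpv (hT.eq_of_adj_of_dist_eq_succ hadj hvw hd hdw)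
  refine fun h => hvD (h.mem_of_mem (D := D) (fun a b hab ha => ?_) ?_)
  · rcases (created_adj.1 hab).2 with hb | ha'
    exacts [(hclosed a b hb).1 ha, (hclosed b a ha').2 ha]
  · simp [hD]

/-- The eccentricity of `v` in a shortest-path tree rooted at a center exceeds its eccentricity in
any subgraph of the host graph by at most the radius. -/
lemma ecc_le_radius_add_ecc {H T G : SimpleGraph V} {c : V} (hc : ecc H c = radius H)
    (hSP : ∀ v, T.edist c v = H.edist c v) (hG : G ≤ H) (v : V) :
    ecc T v ≤ radius H + ecc G v := by
  refine iSup_le fun u => ?_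
  calc T.edist v u ≤ T.edist v c + T.edist c u := SimpleGraph.edist_triangle
    _ = H.edist v c + H.edist c u := by rw [T.edist_comm, hSP, hSP, H.edist_comm]
    _ ≤ ecc G v + radius H := by
      refine add_le_add ((edist_anti hG).trans (edist_le_ecc G v c)) ?_
      rw [← hc]
      exact edist_le_ecc H c u
    _ = radius H + ecc G v := add_comm _ _

end NCG

/-- If `α ≥ ρ_H`, `c` is a center of `H` and `T` is a shortest-path
spanning tree of `H` rooted at `c`, then the strategy profile in which every
vertex buys exactly the edges of `T` towards its children is a Nash equilibrium. -/
theorem bfs_tree_is_nash_equilibrium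
    {V : Type*} [Fintype V] [DecidableEq V]
    (H : SimpleGraph V) (hH : H.Connected) (α : ℝ)
    (hα : (NCG.radius H : ℝ≥0∞) ≤ ENNReal.ofReal α)
    (c : V) (hc : NCG.ecc H c = NCG.radius H)
    (T : SimpleGraph V) (hTH : T ≤ H) (hT : T.IsTree)
    (hSP : ∀ v, T.edist c v = H.edist c v)
    (σ : V → Finset V)
    (hσ : ∀ v w, w ∈ σ v ↔ T.Adj v w ∧ T.edist c w = T.edist c v + 1)
    (hGσ : NCG.created σ = T) :
    NCG.IsNE H α σ := by
  have hvalid : NCG.Valid H σ := fun v w hw => hTH ((hσ v w).1 hw).1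
  refine ⟨hvalid, fun v s hs => ?_⟩
  have hTd : ∀ a b, ((T.dist a b : ℕ) : ℕ∞) = T.edist a b :=
    fun a b => (hT.connected a b).coe_dist_eq_edist
  have hSP' : ∀ u, T.dist c u = H.dist c u := fun u => congrArg ENat.toNat (hSP u)
  have hσ' : ∀ v w, w ∈ σ v ↔ T.Adj v w ∧ T.dist c w = T.dist c v + 1 := by
    intro v w
    rw [hσ, ← hTd, ← hTd]
    norm_cast
  by_cases hsub : σ v ⊆ s
  · rcases hsub.eq_or_ssubset with rfl | hss
    · rw [Function.update_eq_self]
    · have hcard : ((σ v).card : ℝ≥0∞) + 1 ≤ s.card := by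
        exact_mod_cast Finset.card_lt_card hss
      have hecc := NCG.ecc_le_radius_add_ecc hc hSP (NCG.created_le (hvalid.update hs)) v
      have hecc' : (NCG.ecc T v : ℝ≥0∞) ≤
          ENNReal.ofReal α + (NCG.ecc (NCG.created (Function.update σ v s)) v : ℝ≥0∞) := by
        refine le_trans ?_ (add_le_add_left hα _)
        exact_mod_cast hecc
      rw [NCG.cost, NCG.cost, hGσ, Function.update_self]
      calc _ ≤ ENNReal.ofReal α * (σ v).card + (ENNReal.ofReal α +
            (NCG.ecc (NCG.created (Function.update σ v s)) v : ℝ≥0∞)) := by gcongr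
        _ = ENNReal.ofReal α * ((σ v).card + 1) +
            (NCG.ecc (NCG.created (Function.update σ v s)) v : ℝ≥0∞) := by ring
        _ ≤ _ := by gcongr
  · obtain ⟨w, hw, hws⟩ := Finset.not_subset.1 hsub
    have hr := NCG.not_reachable_created_update hH hT hSP' hσ' hs hw hws
    have htop : NCG.ecc (NCG.created (Function.update σ v s)) v = ⊤ := by
      rw [← top_le_iff, ← SimpleGraph.edist_eq_top_of_not_reachable fun h => hr h.symm]
      exact NCG.edist_le_ecc _ v w
    rw [NCG.cost, NCG.cost, htop]
    simp
end

section
/- Let H be a connected simple graph on n vertices, let α ≥ 0, and let σ be a Nash equilibrium of the max-distance network creation game on H such that G = G(σ) is connected. Let u be a center of G, let T be a shortest-path spanning tree of G rooted at u (a spanning tree with d_T(u,v) = d_G(u,v) for every vertex v), and for each player v let k_v be the number of edges of T bought by v under σ, i.e., k_v = |{w : {v,w} ∈ E(T) and w ∈ σ_v}|. Then for every player v, C_v(σ) ≤ α·k_v + 2·ρ_G. -/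
open scoped ENNReal Classical

/-- At a connected Nash equilibrium, if `T` is a shortest-path
spanning tree of `G = G(σ)` rooted at a center `u`, and `k v` is the number of
edges of `T` bought by `v`, then `C_v(σ) ≤ α·k_v + 2·ρ_G` for every player. -/
theorem cost_le_alpha_tree_edges_add_two_radius
    {V : Type*} [Fintype V] [DecidableEq V]
    (H : SimpleGraph V) (hH : H.Connected) (α : ℝ) (hα : 0 ≤ α)
    (σ : V → Finset V) (hNE : NCG.IsNE H α σ)
    (hconn : (NCG.created σ).Connected)
    (u : V) (hu : NCG.ecc (NCG.created σ) u = NCG.radius (NCG.created σ))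
    (T : SimpleGraph V) (hTG : T ≤ NCG.created σ) (hT : T.IsTree)
    (hSP : ∀ v, T.edist u v = (NCG.created σ).edist u v)
    (k : V → ℕ)
    (hk : ∀ v, k v = ((σ v).filter (fun w => T.Adj v w)).card) :
    ∀ v, NCG.cost α σ v ≤
      ENNReal.ofReal α * (k v) + 2 * (NCG.radius (NCG.created σ) : ℝ≥0∞) := by
  intro v
  set σ' := Function.update σ v ((σ v).filter (fun w => T.Adj v w)) with hσ'
  have hdev : NCG.cost α σ v ≤ NCG.cost α σ' v :=
    hNE.2 v _ fun w hw => hNE.1 v w (Finset.mem_filter.1 hw).1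
  have hbought : ∀ a b, T.Adj a b → b ∈ σ a → b ∈ σ' a := by
    intro a b hab hb
    by_cases ha : a = v
    · subst ha
      simp [hσ', hab, hb]
    · simpa [hσ', ha] using hb
  have hTσ' : T ≤ NCG.created σ' := by
    intro a b hab
    have h := hTG hab
    simp only [NCG.created, SimpleGraph.fromRel_adj] at h ⊢
    exact ⟨h.1, h.2.imp (hbought a b hab) (hbought b a hab.symm)⟩
  have hroot : ∀ w, T.edist u w ≤ NCG.radius (NCG.created σ) := fun w => by
    rw [hSP, ← hu]
    exact le_iSup (fun w => (NCG.created σ).edist u w) w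
  have hecc : NCG.ecc (NCG.created σ') v ≤ 2 * NCG.radius (NCG.created σ) := by
    refine iSup_le fun w => ?_
    calc (NCG.created σ').edist v w ≤ T.edist v w := SimpleGraph.edist_anti hTσ'
      _ ≤ T.edist v u + T.edist u w := SimpleGraph.edist_triangle
      _ ≤ NCG.radius (NCG.created σ) + NCG.radius (NCG.created σ) :=
        add_le_add (SimpleGraph.edist_comm (G := T) ▸ hroot v) (hroot w)
      _ = 2 * NCG.radius (NCG.created σ) := (two_mul _).symm
  have hcard : (σ' v).card = k v := by
    rw [hk, hσ', Function.update_self]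
  refine hdev.trans ?_
  unfold NCG.cost
  rw [hcard]
  gcongr
  exact_mod_cast ENat.toENNReal_le.2 hecc
end

section
/- Let H be a connected simple graph on n ≥ 2 vertices with radius ρ_H and let α ≥ 0. Let σ be a Nash equilibrium of the max-distance network creation game on H such that G(σ) is connected, and let τ be any strategy profile such that G(τ) is connected. Then SC(σ) ≤ (1 + 4n/(α + ρ_H))·SC(τ). (This makes precise the upper bound PoA = O(n/(α + ρ_H)).) -/
open scoped ENNReal Classical

namespace NCG

theorem ecc_le_of_connected {V : Type*} [Fintype V] {G : SimpleGraph V} (hG : G.Connected)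
    (v : V) : ecc G v ≤ ((Fintype.card V - 1 : ℕ) : ℕ∞) := by
  refine iSup_le fun u => ?_
  obtain ⟨p, hp⟩ := hG.exists_isPath v u
  have h := hp.length_lt
  exact (SimpleGraph.edist_le p).trans (by exact_mod_cast (by omega : p.length ≤ Fintype.card V - 1))

theorem ecc_anti {V : Type*} {G G' : SimpleGraph V} (h : G ≤ G') (v : V) :
    ecc G' v ≤ ecc G v :=
  iSup_mono fun _ => SimpleGraph.edist_anti h

theorem created_le_of_valid {V : Type*} {H : SimpleGraph V} {σ : V → Finset V}
    (hσ : Valid H σ) : created σ ≤ H := by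
  intro u v h
  rcases ((SimpleGraph.fromRel_adj _ _ _).1 h).2 with h | h
  · exact hσ u v h
  · exact (hσ v u h).symm

theorem exists_buyer {V : Type*} (σ : V → Finset V) (e : (created σ).edgeSet) :
    ∃ p : V × V, s(p.1, p.2) = (e : Sym2 V) ∧ p.2 ∈ σ p.1 := by
  obtain ⟨e, he⟩ := e
  induction e using Sym2.ind with
  | _ u v =>
    rcases ((SimpleGraph.fromRel_adj _ u v).1 (SimpleGraph.mem_edgeSet _ |>.1 he)).2 with h | h
    · exact ⟨(u, v), rfl, h⟩
    · exact ⟨(v, u), Sym2.eq_swap, h⟩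

/-- A connected created graph requires at least `n - 1` purchases. -/
theorem card_sub_one_le_sum_card {V : Type*} [Fintype V] {σ : V → Finset V}
    (hσ : (created σ).Connected) : Fintype.card V - 1 ≤ ∑ v, (σ v).card := by
  have h := hσ.card_vert_le_card_edgeSet_add_one
  choose p hp hpσ using exists_buyer σ
  have hinj : Function.Injective
      (fun e => (⟨(p e).1, (p e).2, hpσ e⟩ : (v : V) × {w // w ∈ σ v})) := by
    intro e e' hee
    have h' := congrArg (fun x : (v : V) × {w // w ∈ σ v} => s(x.1, (x.2 : V))) hee
    exact Subtype.ext ((hp e).symm.trans (h'.trans (hp e')))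
  have hc := Nat.card_le_card_of_injective _ hinj
  rw [Nat.card_sigma] at hc
  simp only [Nat.card_eq_fintype_card, Fintype.card_coe] at h hc
  omega

/-- The edges of a spanning tree of `created σ` can be distributed among players who bought them,
so that any single player may keep only its share without disconnecting the graph. -/
theorem exists_tree_shares {V : Type*} [Fintype V] [DecidableEq V] {σ : V → Finset V}
    (hσ : (created σ).Connected) :
    ∃ s : V → Finset V, (∀ v, s v ⊆ σ v) ∧ ∑ v, (s v).card ≤ Fintype.card V - 1 ∧
      ∀ v, (created (Function.update σ v (s v))).Connected := by
  obtain ⟨T, hTle, hT⟩ := hσ.exists_isTree_le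
  have hbuy (e : T.edgeSet) : ∃ p : V × V, s(p.1, p.2) = (e : Sym2 V) ∧ p.2 ∈ σ p.1 :=
    exists_buyer σ ⟨e, SimpleGraph.edgeSet_mono hTle e.2⟩
  choose p hp hpσ using hbuy
  refine ⟨fun v => (Finset.univ.filter fun e => (p e).1 = v).image fun e => (p e).2,
    fun v w hw => ?_, ?_, fun v => ?_⟩
  · simp only [Finset.mem_image, Finset.mem_filter, Finset.mem_univ, true_and] at hw
    obtain ⟨e, rfl, rfl⟩ := hw
    exact hpσ e
  · calc _ ≤ ∑ v, (Finset.univ.filter fun e => (p e).1 = v).card :=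
          Finset.sum_le_sum fun v _ => Finset.card_image_le
      _ = (Finset.univ : Finset T.edgeSet).card :=
          (Finset.card_eq_sum_card_fiberwise fun _ _ => Finset.mem_coe.2 (Finset.mem_univ _)).symm
      _ ≤ _ := by
          have h := hT.card_edgeFinset
          rw [Finset.card_univ, ← SimpleGraph.edgeFinset_card]
          omega
  · refine hT.connected.mono fun a b hab => ?_
    have key (e : T.edgeSet) : (p e).2 ∈ Function.update σ v
        ((Finset.univ.filter fun e => (p e).1 = v).image fun e => (p e).2) (p e).1 := by
      by_cases h : (p e).1 = v
      · rw [h, Function.update_self]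
        exact Finset.mem_image_of_mem _ (by simpa using h)
      · rw [Function.update_of_ne h]
        exact hpσ e
    refine (SimpleGraph.fromRel_adj _ _ _).2 ⟨hab.ne, ?_⟩
    have hk := key ⟨s(a, b), hab⟩
    rcases Sym2.eq_iff.1 (hp ⟨s(a, b), hab⟩) with ⟨h1, h2⟩ | ⟨h1, h2⟩
    · rw [h1, h2] at hk
      exact Or.inl hk
    · rw [h1, h2] at hk
      exact Or.inr hk

theorem SC_le_of_isNE {V : Type*} [Fintype V] [DecidableEq V] {H : SimpleGraph V} {α : ℝ}
    {σ : V → Finset V} (hNE : IsNE H α σ) (hσ : (created σ).Connected) :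
    SC α σ ≤ ENNReal.ofReal α * ((Fintype.card V - 1 : ℕ) : ℝ≥0∞) +
      (Fintype.card V : ℝ≥0∞) * ((Fintype.card V - 1 : ℕ) : ℝ≥0∞) := by
  obtain ⟨s, hsσ, hs, hconn⟩ := exists_tree_shares hσ
  calc SC α σ ≤ ∑ v, (ENNReal.ofReal α * ((s v).card : ℝ≥0∞) +
        ((Fintype.card V - 1 : ℕ) : ℝ≥0∞)) := by
        refine Finset.sum_le_sum fun v _ =>
          (hNE.2 v (s v) fun w hw => hNE.1 v w (hsσ v hw)).trans ?_
        rw [cost, Function.update_self]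
        gcongr
        have h := ENat.toENNReal_mono (ecc_le_of_connected (hconn v) v)
        rwa [ENat.toENNReal_coe] at h
    _ ≤ _ := by
        rw [Finset.sum_add_distrib, ← Finset.mul_sum, Finset.sum_const, Finset.card_univ,
          nsmul_eq_mul]
        gcongr
        exact_mod_cast hs

theorem le_SC {V : Type*} [Fintype V] {H : SimpleGraph V} (α : ℝ) {τ : V → Finset V}
    (hτ : Valid H τ) (hconn : (created τ).Connected) :
    ENNReal.ofReal α * ((Fintype.card V - 1 : ℕ) : ℝ≥0∞) +
      (Fintype.card V : ℝ≥0∞) * (radius H : ℝ≥0∞) ≤ SC α τ := by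
  calc _ ≤ ∑ v, (ENNReal.ofReal α * ((τ v).card : ℝ≥0∞) + (radius H : ℝ≥0∞)) := by
        rw [Finset.sum_add_distrib, ← Finset.mul_sum, Finset.sum_const, Finset.card_univ,
          nsmul_eq_mul]
        gcongr
        exact_mod_cast card_sub_one_le_sum_card hconn
    _ ≤ _ := by
        refine Finset.sum_le_sum fun v _ => ?_
        rw [cost]
        gcongr
        exact (iInf_le _ v).trans (ecc_anti (created_le_of_valid hτ) v)

theorem one_le_radius {V : Type*} [Nontrivial V] (G : SimpleGraph V) : 1 ≤ radius G := by
  refine le_iInf fun v => ?_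
  obtain ⟨u, hu⟩ := exists_ne v
  refine le_trans ?_ (le_iSup _ u)
  rw [Order.one_le_iff_pos]
  exact SimpleGraph.edist_pos_of_ne hu.symm

theorem radius_ne_top {V : Type*} [Fintype V] {G : SimpleGraph V} (hG : G.Connected) :
    radius G ≠ ⊤ := by
  obtain ⟨v⟩ := hG.nonempty
  exact ne_top_of_le_ne_top (ENat.natCast_ne_top _) ((iInf_le _ v).trans (ecc_le_of_connected hG v))

end NCG


/-- For any connected Nash equilibrium `σ` and any connected
strategy profile `τ`, `SC(σ) ≤ (1 + 4n/(α + ρ_H))·SC(τ)`; this makes precise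
the upper bound `PoA = O(n/(α + ρ_H))`. -/
theorem poa_upper_bound
    {V : Type*} [Fintype V] [DecidableEq V]
    (H : SimpleGraph V) (hH : H.Connected) (hn : 2 ≤ Fintype.card V)
    (α : ℝ) (hα : 0 ≤ α)
    (σ : V → Finset V) (hNE : NCG.IsNE H α σ)
    (hσconn : (NCG.created σ).Connected)
    (τ : V → Finset V) (hτ : NCG.Valid H τ)
    (hτconn : (NCG.created τ).Connected) :
    NCG.SC α σ ≤
      (1 + 4 * (Fintype.card V : ℝ≥0∞) /
        (ENNReal.ofReal α + (NCG.radius H : ℝ≥0∞))) * NCG.SC α τ := by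
  have : Nontrivial V := Fintype.one_lt_card_iff_nontrivial.1 hn
  have hlow := NCG.le_SC α hτ hτconn
  have hup := NCG.SC_le_of_isNE hNE hσconn
  have hR : (NCG.radius H : ℝ≥0∞) ≠ ⊤ := by simpa using NCG.radius_ne_top hH
  have hR1 : (1 : ℝ≥0∞) ≤ (NCG.radius H : ℝ≥0∞) := by
    simpa using ENat.toENNReal_mono (NCG.one_le_radius H)
  set A := ENNReal.ofReal α
  set R : ℝ≥0∞ := (NCG.radius H : ℝ≥0∞)
  set N := (Fintype.card V : ℝ≥0∞)
  set m := ((Fintype.card V - 1 : ℕ) : ℝ≥0∞)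
  have hmN : m ≤ N := Nat.cast_le.2 (Nat.sub_le _ _)
  have hne : A + R ≠ 0 := fun h => by simp [(add_eq_zero.1 h).2] at hR1
  have hnt : A + R ≠ ⊤ := ENNReal.add_ne_top.2 ⟨ENNReal.ofReal_ne_top, hR⟩
  have hSC : (A + R) * m ≤ NCG.SC α τ := by
    refine le_trans ?_ hlow
    rw [add_mul, mul_comm R]
    gcongr
  calc NCG.SC α σ ≤ A * m + N * m := hup
    _ ≤ NCG.SC α τ + 4 * N * m := by
        gcongr
        · exact le_self_add.trans hlow
        · exact le_mul_of_one_le_left zero_le (by norm_num)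
    _ = NCG.SC α τ + 4 * N / (A + R) * ((A + R) * m) := by
        rw [← mul_assoc (4 * N / (A + R)), ENNReal.div_mul_cancel hne hnt]
    _ ≤ NCG.SC α τ + 4 * N / (A + R) * NCG.SC α τ := by gcongr
    _ = _ := by rw [add_mul, one_mul]
end

section
/- Let H be a connected finite simple graph with diameter δ_H, and let G be a connected spanning subgraph of H with ℓ = |E(H)| − |E(G)| (i.e., G is obtained from H by deleting ℓ edges while preserving connectivity). Then the diameter of G satisfies δ_G ≤ (ℓ + 1)·δ_H. -/
open scoped ENNReal

namespace SimpleGraph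

variable {V : Type*}

/-- The coboundary modulo two of a `0`-cochain on the vertices. -/
def edgeCoboundary (s : V → ZMod 2) : Sym2 V → ZMod 2 :=
  Sym2.lift ⟨fun a b => s a + s b, fun _ _ => add_comm _ _⟩

@[simp]
theorem edgeCoboundary_mk (s : V → ZMod 2) (a b : V) :
    edgeCoboundary s s(a, b) = s a + s b := rfl

theorem Walk.sum_map_edgeCoboundary {H : SimpleGraph V} (s : V → ZMod 2) {x y : V}
    (w : H.Walk x y) : (w.edges.map (edgeCoboundary s)).sum = s x + s y := by
  induction w with
  | nil => simp [CharTwo.add_self_eq_zero]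
  | cons h p ih =>
    simp only [Walk.edges_cons, List.map_cons, List.sum_cons, ih, edgeCoboundary_mk]
    rw [add_assoc, CharTwo.add_cancel_left]

/-- The indicator of the superlevel set `{k ≤ f}`. -/
def superlevel (f : V → ℕ) (k : ℕ) (x : V) : ZMod 2 := if k ≤ f x then 1 else 0

theorem eq_of_edgeCoboundary_superlevel_ne_zero {G : SimpleGraph V} {f : V → ℕ}
    (hf : ∀ a b, G.Adj a b → f a ≤ f b + 1) {e : Sym2 V} (he : e ∈ G.edgeSet) {k l : ℕ}
    (hk : edgeCoboundary (superlevel f k) e ≠ 0) (hl : edgeCoboundary (superlevel f l) e ≠ 0) :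
    k = l := by
  induction e using Sym2.ind with
  | _ a b =>
    have h1 := hf a b he
    have h2 := hf b a (G.adj_symm he)
    simp only [edgeCoboundary_mk, superlevel] at hk hl
    split_ifs at hk hl <;> first | omega | (exfalso; revert hk; decide) | (exfalso; revert hl; decide)

theorem Walk.le_add_length_of_edges_subset {H G : SimpleGraph V} {f : V → ℕ}
    (hf : ∀ a b, G.Adj a b → f a ≤ f b + 1) {x y : V} (w : H.Walk x y)
    (hw : ∀ e ∈ w.edges, e ∈ G.edgeSet) : f y ≤ f x + w.length := by
  induction w with
  | nil => simp
  | cons h p ih =>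
    simp only [Walk.edges_cons, List.mem_cons, forall_eq_or_imp] at hw
    have h1 := ih hw.2
    have h2 := hf _ _ (G.adj_symm ((G.mem_edgeSet).1 hw.1))
    simp only [Walk.length_cons]
    omega

/-- Let `f` change by at most one along the edges of `G` and attain all values up to `n * D + 1`.
If any two vertices are joined by a path of length at most `D` in `H`, then `H` has at least `n`
edges outside `G`. -/
theorem le_ncard_edgeSet_sdiff [Fintype V] {G H : SimpleGraph V} {f : V → ℕ} {D n : ℕ}
    (hf : ∀ a b, G.Adj a b → f a ≤ f b + 1)
    (hsurj : ∀ k ≤ n * D + 1, ∃ x, f x = k)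
    (hH : ∀ x y, ∃ w : H.Walk x y, w.IsPath ∧ w.length ≤ D) :
    n ≤ (H.edgeSet \ G.edgeSet).ncard := by
  classical
  by_contra! hcard
  have hle : ∀ i : Fin n, ((i : ℕ) + 1) * D ≤ n * D := fun i => Nat.mul_le_mul_right _ i.2
  have hwalk : ∀ i : Fin n, ∃ F : Finset (Sym2 V), (∀ e ∈ F, e ∈ H.edgeSet) ∧
      (F.filter (· ∈ G.edgeSet)).card + 1 ≤ D ∧
      ∀ k, ∑ e ∈ F, edgeCoboundary (superlevel f k) e =
        if i * D + 1 ≤ k ∧ k ≤ (i + 1) * D + 1 then 1 else 0 := by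
    intro i
    have := hle i
    obtain ⟨x, hx⟩ := hsurj (i * D) (by rw [add_mul] at this; omega)
    obtain ⟨y, hy⟩ := hsurj ((i + 1) * D + 1) (by omega)
    obtain ⟨w, hw, hlen⟩ := hH x y
    refine ⟨w.edges.toFinset, fun e he => w.edges_subset_edgeSet (by simpa using he), ?_, ?_⟩
    · have hc : w.edges.toFinset.card ≤ D := by
        rw [List.toFinset_card_of_nodup hw.edges_nodup, Walk.length_edges]; exact hlen
      refine lt_of_lt_of_le (Finset.card_lt_card ?_) hc
      rw [Finset.filter_ssubset]
      by_contra! hG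
      have := w.le_add_length_of_edges_subset hf (by simpa using hG)
      rw [add_mul] at hy
      omega
    · intro k
      rw [List.sum_toFinset _ hw.edges_nodup, Walk.sum_map_edgeCoboundary]
      simp only [superlevel, hx, hy]
      have : (i : ℕ) * D ≤ (i + 1) * D := Nat.mul_le_mul_right _ (Nat.le_succ _)
      split_ifs <;> first | omega | decide
  choose F hFH hFcard hFsum using hwalk
  obtain ⟨g, hg0, j, hj⟩ : ∃ g : Fin n → ZMod 2,
      (∀ e ∈ H.edgeSet \ G.edgeSet, ∑ i, g i * (if e ∈ F i then 1 else 0) = 0) ∧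
      ∃ i, g i ≠ 0 := by
    let v : Fin n → (↥(H.edgeSet \ G.edgeSet) → ZMod 2) := fun i e => if e.1 ∈ F i then 1 else 0
    have hv : ¬ LinearIndependent (ZMod 2) v := by
      intro h
      have := h.fintype_card_le_finrank
      rw [Module.finrank_fintype_fun_eq_card, Fintype.card_fin, ← Nat.card_eq_fintype_card,
        Nat.card_coe_set_eq] at this
      omega
    obtain ⟨g, hg, hne⟩ := Fintype.not_linearIndependent_iff.1 hv
    refine ⟨g, fun e he => ?_, hne⟩
    simpa [v] using congrFun hg ⟨e, he⟩
  have hD : 1 ≤ D := le_trans (by omega) (hFcard j)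
  let I : Finset (Fin n) := Finset.univ.filter (g · ≠ 0)
  have hI : I.Nonempty := ⟨j, by simpa [I] using hj⟩
  have hgI : ∀ i ∈ I, g i = 1 := fun i hi => by
    have : g i ≠ 0 := by simpa [I] using hi
    generalize g i = a at this
    revert this; revert a; decide
  have hgI' : ∀ i ∉ I, g i = 0 := fun i hi => by simpa [I] using hi
  obtain ⟨m, hmI, hm⟩ : ∃ m ∈ I, ∀ i ∈ I, m ≤ i := ⟨I.min' hI, I.min'_mem hI, I.min'_le⟩
  let T := I.biUnion fun i => (F i).filter (· ∈ G.edgeSet)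
  have hT : T.card ≤ I.card * (D - 1) :=
    Finset.card_biUnion_le_card_mul _ _ _ fun i _ => by have := hFcard i; omega
  let K₀ := I.biUnion fun i : Fin n => Finset.Icc (i * D + 2) ((i + 1) * D)
  have hblock : ∀ i i' : Fin n, i < i' → ((i : ℕ) + 1) * D ≤ i' * D := fun i i' h =>
    Nat.mul_le_mul_right _ h
  have hK₀ : K₀.card = I.card * (D - 1) := by
    rw [Finset.card_biUnion]
    · rw [Finset.sum_const_nat]
      intro i _
      rw [Nat.card_Icc, add_mul]; omega
    · intro i _ i' _ hne
      rw [Function.onFun, Finset.disjoint_left]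
      intro k hk hk'
      simp only [Finset.mem_Icc] at hk hk'
      rcases lt_or_gt_of_ne hne with h | h
      · have := hblock _ _ h; omega
      · have := hblock _ _ h; omega
  have hmK : (m : ℕ) * D + 1 ∉ K₀ := by
    simp only [K₀, Finset.mem_biUnion, Finset.mem_Icc, not_exists, not_and]
    intro i hi h
    rcases (hm i hi).lt_or_eq with h' | h'
    · have := hblock _ _ h'
      rw [add_mul] at this
      omega
    · have : (m : ℕ) = i := congrArg Fin.val h'
      rw [this] at h; omega
  -- each such level is covered by exactly one of the selected blocks
  have hodd : ∀ k ∈ insert ((m : ℕ) * D + 1) K₀,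
      ∑ i, g i * ∑ e ∈ F i, edgeCoboundary (superlevel f k) e = 1 := by
    intro k hk
    obtain ⟨i, hi, hik, hun⟩ : ∃ i ∈ I, (i * D + 1 ≤ k ∧ k ≤ (i + 1) * D + 1) ∧
        ∀ i' ∈ I, i' ≠ i → ¬ (i' * D + 1 ≤ k ∧ k ≤ (i' + 1) * D + 1) := by
      rcases Finset.mem_insert.1 hk with rfl | hk
      · refine ⟨m, hmI, ⟨le_rfl, by rw [add_mul]; omega⟩, fun i' hi' hne h => ?_⟩
        have := hblock m i' (lt_of_le_of_ne (hm i' hi') hne.symm)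
        rw [add_mul] at this
        omega
      · simp only [K₀, Finset.mem_biUnion, Finset.mem_Icc] at hk
        obtain ⟨i, hi, hik⟩ := hk
        refine ⟨i, hi, by omega, fun i' hi' hne h => ?_⟩
        rcases lt_or_gt_of_ne hne with h' | h'
        · have := hblock _ _ h'; omega
        · have := hblock _ _ h'; omega
    rw [Finset.sum_eq_single i]
    · rw [hFsum, if_pos hik, hgI i hi, one_mul]
    · intro i' _ hne
      by_cases hi' : i' ∈ I
      · rw [hFsum, if_neg (hun i' hi' hne), mul_zero]
      · rw [hgI' i' hi', zero_mul]
    · simp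
  have hcross : ∀ k ∈ insert ((m : ℕ) * D + 1) K₀, ∃ e ∈ T,
      edgeCoboundary (superlevel f k) e ≠ 0 := by
    intro k hk
    by_contra! hzero
    refine one_ne_zero (α := ZMod 2) ((hodd k hk).symm.trans ?_)
    have hswap : ∑ i, g i * ∑ e ∈ F i, edgeCoboundary (superlevel f k) e =
        ∑ e, (∑ i, g i * if e ∈ F i then 1 else 0) * edgeCoboundary (superlevel f k) e := by
      simp_rw [Finset.sum_mul]
      rw [Finset.sum_comm]
      refine Finset.sum_congr rfl fun i _ => ?_
      simp [Finset.mul_sum]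
    rw [hswap]
    refine Finset.sum_eq_zero fun e _ => ?_
    by_cases heG : e ∈ G.edgeSet
    · rw [Finset.sum_mul]
      refine Finset.sum_eq_zero fun i _ => ?_
      by_cases hi : i ∈ I
      · by_cases heF : e ∈ F i
        · rw [hzero e (Finset.mem_biUnion.2 ⟨i, hi, Finset.mem_filter.2 ⟨heF, heG⟩⟩), mul_zero]
        · simp [heF]
      · simp [hgI' i hi]
    · by_cases heH : e ∈ H.edgeSet
      · rw [hg0 e ⟨heH, heG⟩, zero_mul]
      · have : ∀ i, e ∉ F i := fun i h => heH (hFH i e h)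
        simp [this]
  obtain ⟨x₀, -⟩ := hsurj 0 (Nat.zero_le _)
  have : Nonempty (Sym2 V) := ⟨s(x₀, x₀)⟩
  choose! c hcT hc using hcross
  have hcard_le : (insert ((m : ℕ) * D + 1) K₀).card ≤ T.card := by
    refine Finset.card_le_card_of_injOn c hcT fun k hk l hl hkl => ?_
    have hG : c k ∈ G.edgeSet := by
      obtain ⟨i, -, h⟩ := Finset.mem_biUnion.1 (hcT k hk)
      exact (Finset.mem_filter.1 h).2
    exact eq_of_edgeCoboundary_superlevel_ne_zero hf hG (hc k hk) (hkl ▸ hc l hl)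
  rw [Finset.card_insert_of_notMem hmK, hK₀] at hcard_le
  omega

/-- Every value up to `G.dist u v` is the distance from `u` to some vertex. -/
theorem Connected.exists_dist_eq {G : SimpleGraph V} (hG : G.Connected) {u v : V} {k : ℕ}
    (hk : k ≤ G.dist u v) : ∃ x, G.dist u x = k := by
  obtain ⟨w, hw⟩ := hG.exists_walk_length_eq_dist u v
  refine ⟨w.getVert k, le_antisymm ?_ ?_⟩
  · exact (dist_le (w.take k)).trans (by simp)
  · have h1 : G.dist (w.getVert k) v ≤ w.length - k := (dist_le (w.drop k)).trans (by simp)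
    have h2 := hG.dist_triangle (u := u) (v := w.getVert k) (w := v)
    omega

end SimpleGraph

/-- If `G` is a connected spanning subgraph of a connected graph
`H` obtained by deleting `ℓ` edges, then `δ_G ≤ (ℓ + 1)·δ_H`. -/
theorem diameter_of_spanning_subgraph
    {V : Type*} [Fintype V]
    (H : SimpleGraph V) (hH : H.Connected)
    (G : SimpleGraph V) (hGH : G ≤ H) (hG : G.Connected)
    (ℓ : ℕ) (hℓ : ℓ = H.edgeSet.ncard - G.edgeSet.ncard) :
    G.ediam ≤ (ℓ + 1) * H.ediam := by
  have := hH.nonempty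
  have htop : H.ediam ≠ ⊤ := SimpleGraph.connected_iff_ediam_ne_top.1 hH
  have hcoe : H.ediam = (H.diam : ℕ∞) := (ENat.natCast_toNat htop).symm
  rw [hcoe]
  refine SimpleGraph.ediam_le_of_edist_le fun u v => ?_
  rw [← (hG u v).coe_dist_eq_edist]
  norm_cast
  by_contra! hlt
  have hn : ℓ + 1 ≤ (H.edgeSet \ G.edgeSet).ncard := by
    refine SimpleGraph.le_ncard_edgeSet_sdiff (f := G.dist u) (D := H.diam) ?_ ?_ ?_
    · intro a b hab
      have h := hG.dist_triangle (u := u) (v := b) (w := a)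
      rwa [SimpleGraph.dist_eq_one_iff_adj.2 hab.symm] at h
    · exact fun k hk => hG.exists_dist_eq (hk.trans hlt)
    · intro x y
      obtain ⟨w, hw, hlen⟩ := hH.exists_path_of_dist x y
      exact ⟨w, hw, hlen.trans_le (SimpleGraph.dist_le_diam htop)⟩
  rw [Set.ncard_sdiff (SimpleGraph.edgeSet_mono hGH)] at hn
  omega
end

section
/- Let H be a connected simple graph, let α ≥ 0, and let σ be a Nash equilibrium of the max-distance network creation game on H such that G = G(σ) is connected. Then for every pair of vertices u, v, |ε_G(u) − ε_G(v)| ≤ (1 + α)·d_H(u,v). -/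
open scoped ENNReal Classical

namespace NCG

variable {V : Type*}

theorem created_mono {σ τ : V → Finset V} (h : ∀ v, σ v ⊆ τ v) : created σ ≤ created τ := by
  intro a b hab
  rw [created, SimpleGraph.fromRel_adj] at hab ⊢
  exact ⟨hab.1, hab.2.imp (fun hb => h a hb) (fun ha => h b ha)⟩

theorem ecc_le_of_adj {G G' : SimpleGraph V} (hle : G ≤ G') {u v : V} (huv : G'.Adj u v) :
    ecc G' u ≤ ecc G v + 1 := by
  refine iSup_le fun x => ?_
  calc G'.edist u x ≤ G'.edist u v + G'.edist v x := SimpleGraph.edist_triangle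
    _ ≤ 1 + ecc G v := by
        refine add_le_add (SimpleGraph.edist_eq_one_iff_adj.mpr huv).le ?_
        exact (SimpleGraph.edist_anti hle).trans (le_iSup (fun y => G.edist v y) x)
    _ = ecc G v + 1 := add_comm _ _

/-- At equilibrium, buying an edge of the host graph gains at most its price. -/
theorem IsNE.ecc_le_of_adj [DecidableEq V] {H : SimpleGraph V} {α : ℝ} {σ : V → Finset V}
    (hNE : IsNE H α σ) {u v : V} (huv : H.Adj u v) :
    (ecc (created σ) u : ℝ≥0∞) ≤ (ecc (created σ) v : ℝ≥0∞) + (1 + ENNReal.ofReal α) := by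
  set τ := Function.update σ u (insert v (σ u)) with hτ
  have hτu : τ u = insert v (σ u) := Function.update_self ..
  have hmono : created σ ≤ created τ := by
    refine created_mono fun w => ?_
    rcases eq_or_ne w u with rfl | hw
    · rw [hτu]
      exact Finset.subset_insert _ _
    · rw [hτ, Function.update_of_ne hw]
  have hadj : (created τ).Adj u v := by
    rw [created, SimpleGraph.fromRel_adj]
    exact ⟨huv.ne, Or.inl (hτu ▸ Finset.mem_insert_self _ _)⟩
  have hecc : (ecc (created τ) u : ℝ≥0∞) ≤ (ecc (created σ) v : ℝ≥0∞) + 1 := by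
    exact_mod_cast NCG.ecc_le_of_adj hmono hadj
  have hcard : ((τ u).card : ℝ≥0∞) ≤ (σ u).card + 1 := by
    rw [hτu]
    exact_mod_cast Finset.card_insert_le _ _
  have hcost : cost α σ u ≤ cost α τ u := by
    refine hNE.2 u _ fun w hw => ?_
    rcases Finset.mem_insert.mp hw with rfl | hw
    · exact huv
    · exact hNE.1 u w hw
  have hfin : ENNReal.ofReal α * (σ u).card ≠ ⊤ :=
    ENNReal.mul_ne_top ENNReal.ofReal_ne_top (ENNReal.natCast_ne_top _)
  refine (ENNReal.add_le_add_iff_left hfin).mp ?_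
  calc _ ≤ ENNReal.ofReal α * (τ u).card + (ecc (created τ) u : ℝ≥0∞) := hcost
    _ ≤ ENNReal.ofReal α * ((σ u).card + 1) + ((ecc (created σ) v : ℝ≥0∞) + 1) := by gcongr
    _ = _ := by ring

theorem IsNE.ecc_le_of_walk [DecidableEq V] {H : SimpleGraph V} {α : ℝ} {σ : V → Finset V}
    (hNE : IsNE H α σ) {u v : V} (p : H.Walk u v) :
    (ecc (created σ) u : ℝ≥0∞) ≤
      (ecc (created σ) v : ℝ≥0∞) + (1 + ENNReal.ofReal α) * p.length := by
  induction p with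
  | nil => simp
  | cons h p ih =>
    refine (hNE.ecc_le_of_adj h).trans ((add_le_add_left ih _).trans_eq ?_)
    rw [SimpleGraph.Walk.length_cons]
    push_cast
    ring

theorem IsNE.ecc_le_of_edist [DecidableEq V] {H : SimpleGraph V} (hH : H.Connected) {α : ℝ}
    {σ : V → Finset V} (hNE : IsNE H α σ) (u v : V) :
    (ecc (created σ) u : ℝ≥0∞) ≤
      (ecc (created σ) v : ℝ≥0∞) + (1 + ENNReal.ofReal α) * (H.edist u v : ℝ≥0∞) := by
  obtain ⟨p, hp⟩ := hH.exists_walk_length_eq_edist u v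
  rw [← hp]
  exact_mod_cast hNE.ecc_le_of_walk p

end NCG

/-- At a connected Nash equilibrium, for every pair of vertices
`u, v`, `|ε_G(u) − ε_G(v)| ≤ (1 + α)·d_H(u,v)`. -/
theorem ecc_diff_le_dist
    {V : Type*} [Fintype V] [DecidableEq V]
    (H : SimpleGraph V) (hH : H.Connected) (α : ℝ) (hα : 0 ≤ α)
    (σ : V → Finset V) (hNE : NCG.IsNE H α σ)
    (hconn : (NCG.created σ).Connected)
    (u v : V) :
    (NCG.ecc (NCG.created σ) u : ℝ≥0∞) ≤
        (NCG.ecc (NCG.created σ) v : ℝ≥0∞) +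
          (1 + ENNReal.ofReal α) * (H.edist u v : ℝ≥0∞) ∧
    (NCG.ecc (NCG.created σ) v : ℝ≥0∞) ≤
        (NCG.ecc (NCG.created σ) u : ℝ≥0∞) +
          (1 + ENNReal.ofReal α) * (H.edist u v : ℝ≥0∞) := by
  refine ⟨hNE.ecc_le_of_edist hH u v, ?_⟩
  rw [SimpleGraph.edist_comm]
  exact hNE.ecc_le_of_edist hH v u
end

section
/- For every integer k ≥ 1 and all vertices (i,j) and (i',j') of the rotated torus T_k, the graph distance satisfies d_{T_k}((i,j),(i',j')) = max{d̄(i,i'), d̄(j,j')}, where d̄ denotes the circular distance on ℤ_{2k}. -/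
open scoped ENNReal

/-- Vertices of the rotated torus: pairs `(i,j) ∈ ℤ_{2k} × ℤ_{2k}` with
`i + j` even. -/
def TorusVert (k : ℕ) : Type :=
  {x : ZMod (2 * k) × ZMod (2 * k) // Even (x.1 + x.2)}

/-- The 2D-torus-rotated-45°: `(i,j)` is adjacent to the four vertices
`(i ± 1, j ± 1)` (coordinates modulo `2k`). -/
def rotatedTorus (k : ℕ) : SimpleGraph (TorusVert k) :=
  SimpleGraph.fromRel (fun a b =>
    (b.1.1 - a.1.1 = 1 ∨ b.1.1 - a.1.1 = -1) ∧
    (b.1.2 - a.1.2 = 1 ∨ b.1.2 - a.1.2 = -1))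

/-- Circular distance on `ℤ_m`: `d̄(a,b) = min{r, m − r}` where `r` is the
canonical representative of `a − b`. -/
def cdist {m : ℕ} (a b : ZMod m) : ℕ :=
  min (a - b).val (m - (a - b).val)

/-- Eccentricity of a vertex (`⊤` if the graph is disconnected). -/
noncomputable def ecc {V : Type*} (G : SimpleGraph V) (v : V) : ℕ∞ :=
  ⨆ u, G.edist v u

theorem cdist_eq_natAbs_valMinAbs {m : ℕ} [NeZero m] (a b : ZMod m) :
    cdist a b = (b - a).valMinAbs.natAbs := by
  rw [cdist, ← ZMod.valMinAbs_natAbs_eq_min, ← neg_sub b a, ZMod.natAbs_valMinAbs_neg]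

theorem natAbs_valMinAbs_intCast_le {m : ℕ} [NeZero m] (z : ℤ) :
    (z : ZMod m).valMinAbs.natAbs ≤ z.natAbs :=
  ZMod.natAbs_min_of_le_div_two m _ _ (ZMod.coe_valMinAbs _) (ZMod.natAbs_valMinAbs_le _)

theorem cdist_triangle {m : ℕ} [NeZero m] (a b c : ZMod m) :
    cdist a c ≤ cdist a b + cdist b c := by
  simp only [cdist_eq_natAbs_valMinAbs]
  have h : c - a = (((b - a).valMinAbs + (c - b).valMinAbs : ℤ) : ZMod m) := by
    push_cast
    simp
  rw [h]
  exact (natAbs_valMinAbs_intCast_le _).trans (Int.natAbs_add_le _ _)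

theorem cdist_le_one_of_sub_eq {m : ℕ} [NeZero m] {a b : ZMod m}
    (h : b - a = 1 ∨ b - a = -1) : cdist a b ≤ 1 := by
  rw [cdist_eq_natAbs_valMinAbs]
  rcases h with h | h <;> rw [h]
  · simpa using natAbs_valMinAbs_intCast_le (m := m) 1
  · simpa using natAbs_valMinAbs_intCast_le (m := m) (-1)

theorem rotatedTorus_adj_iff {k : ℕ} (hk : 1 ≤ k) (a b : TorusVert k) :
    (rotatedTorus k).Adj a b ↔
      (b.1.1 - a.1.1 = 1 ∨ b.1.1 - a.1.1 = -1) ∧ (b.1.2 - a.1.2 = 1 ∨ b.1.2 - a.1.2 = -1) := by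
  have : Fact (1 < 2 * k) := ⟨by omega⟩
  rw [rotatedTorus, SimpleGraph.fromRel_adj]
  constructor
  · rintro ⟨-, h | h⟩
    · exact h
    · rw [← neg_sub b.1.1, ← neg_sub b.1.2, neg_inj, neg_inj, neg_eq_iff_eq_neg,
        neg_eq_iff_eq_neg] at h
      exact ⟨h.1.symm, h.2.symm⟩
  · refine fun h => ⟨?_, Or.inl h⟩
    rintro rfl
    simp at h

theorem max_cdist_le_length {k : ℕ} (hk : 1 ≤ k) {a b : TorusVert k}
    (w : (rotatedTorus k).Walk a b) :
    max (cdist a.1.1 b.1.1) (cdist a.1.2 b.1.2) ≤ w.length := by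
  have : NeZero (2 * k) := ⟨by omega⟩
  induction w with
  | nil => simp [cdist]
  | @cons a b c h w ih =>
    obtain ⟨h₁, h₂⟩ := (rotatedTorus_adj_iff hk a b).1 h
    have := cdist_triangle a.1.1 b.1.1 c.1.1
    have := cdist_triangle a.1.2 b.1.2 c.1.2
    have := cdist_le_one_of_sub_eq h₁
    have := cdist_le_one_of_sub_eq h₂
    rw [SimpleGraph.Walk.length_cons]
    omega

theorem Int.exists_unit_step {n : ℕ} {p : ℤ} (hp : p.natAbs ≤ n + 1)
    (h : Even (p + (n + 1 : ℕ))) :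
    ∃ s : ℤ, (s = 1 ∨ s = -1) ∧ (p - s).natAbs ≤ n ∧ Even (p - s + n) := by
  rw [Int.even_iff] at h
  rcases lt_or_ge 0 p with hp₀ | hp₀
  · exact ⟨1, Or.inl rfl, by omega, by rw [Int.even_iff]; omega⟩
  · exact ⟨-1, Or.inr rfl, by omega, by rw [Int.even_iff]; omega⟩

theorem rotatedTorus_edist_le {k : ℕ} (hk : 1 ≤ k) (n : ℕ) :
    ∀ (a b : TorusVert k) (p q : ℤ), b.1.1 - a.1.1 = p → b.1.2 - a.1.2 = q →
      p.natAbs ≤ n → q.natAbs ≤ n → Even (p + n) → Even (q + n) →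
      (rotatedTorus k).edist a b ≤ n := by
  induction n with
  | zero =>
    intro a b p q hp hq hpn hqn _ _
    obtain rfl : p = 0 := by omega
    obtain rfl : q = 0 := by omega
    have : a = b := by
      apply Subtype.ext
      apply Prod.ext
      · exact (sub_eq_zero.1 (by simpa using hp)).symm
      · exact (sub_eq_zero.1 (by simpa using hq)).symm
    simp [this]
  | succ n ih =>
    intro a b p q hp hq hpn hqn hpe hqe
    obtain ⟨s, hs, hsn, hse⟩ := Int.exists_unit_step hpn hpe
    obtain ⟨t, ht, htn, hte⟩ := Int.exists_unit_step hqn hqe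
    have hst : Even (s + t) := by
      rcases hs with rfl | rfl <;> rcases ht with rfl | rfl <;> decide
    let c : TorusVert k := ⟨(a.1.1 + s, a.1.2 + t), by
      have h := a.2.add (hst.map (Int.castRingHom (ZMod (2 * k))))
      rw [eq_intCast, Int.cast_add, add_add_add_comm] at h
      exact h⟩
    have hac : (rotatedTorus k).Adj a c := by
      rw [rotatedTorus_adj_iff hk]
      simp only [c, add_sub_cancel_left]
      constructor
      · rcases hs with rfl | rfl <;> simp
      · rcases ht with rfl | rfl <;> simp
    have hcb : (rotatedTorus k).edist c b ≤ n := by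
      refine ih c b (p - s) (q - t) ?_ ?_ hsn htn hse hte
      · simp only [c, Int.cast_sub, ← hp]
        ring
      · simp only [c, Int.cast_sub, ← hq]
        ring
    calc (rotatedTorus k).edist a b
        ≤ (rotatedTorus k).edist a c + (rotatedTorus k).edist c b :=
          SimpleGraph.edist_triangle
      _ ≤ 1 + n := add_le_add (SimpleGraph.edist_eq_one_iff_adj.2 hac).le hcb
      _ = (n + 1 : ℕ) := by rw [add_comm, Nat.cast_add, Nat.cast_one]

theorem ZMod.even_of_even_intCast {k : ℕ} {z : ℤ} (h : Even (z : ZMod (2 * k))) : Even z := by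
  have h₂ := h.map (ZMod.castHom (dvd_mul_right 2 k) (ZMod 2))
  rw [map_intCast] at h₂
  obtain ⟨r, hr⟩ := h₂
  rw [CharTwo.add_self_eq_zero, ZMod.intCast_eq_zero_iff_even] at hr
  exact hr

/-- the graph distance in the rotated torus `T_k` is
`max{d̄(i,i'), d̄(j,j')}`. -/
theorem rotatedTorus_edist (k : ℕ) (hk : 1 ≤ k) (a b : TorusVert k) :
    (rotatedTorus k).edist a b =
      ((max (cdist a.1.1 b.1.1) (cdist a.1.2 b.1.2) : ℕ) : ℕ∞) := by
  have : NeZero (2 * k) := ⟨by omega⟩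
  apply le_antisymm
  · set p := (b.1.1 - a.1.1).valMinAbs with hp
    set q := (b.1.2 - a.1.2).valMinAbs with hq
    rw [cdist_eq_natAbs_valMinAbs, cdist_eq_natAbs_valMinAbs, ← hp, ← hq]
    have hpq : Even (p + q) := by
      apply ZMod.even_of_even_intCast (k := k)
      rw [Int.cast_add, hp, hq, ZMod.coe_valMinAbs, ZMod.coe_valMinAbs, sub_add_sub_comm]
      exact b.2.sub a.2
    rw [Int.even_iff] at hpq
    refine rotatedTorus_edist_le hk _ a b p q (ZMod.coe_valMinAbs _).symm
      (ZMod.coe_valMinAbs _).symm (le_max_left _ _) (le_max_right _ _) ?_ ?_ <;>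
    · rw [Int.even_iff]
      omega
  · rw [SimpleGraph.edist]
    exact le_iInf fun w => Nat.cast_le.2 (max_cdist_le_length hk w)
end

section
/- For every integer k ≥ 1 and every edge e of the rotated torus T_k, each of the two endpoints of e has eccentricity at least k + 1 in the graph T_k − e obtained from T_k by deleting the edge e (where distances between vertices in different connected components, and hence the corresponding eccentricities, are +∞). -/
open scoped ENNReal

/-- Adjacent vertices of the rotated torus differ by integral signs in both coordinates. -/
lemma rotatedTorus_adj_exists_sign {k : ℕ} {x y : TorusVert k} (h : (rotatedTorus k).Adj x y) :
    ∃ s t : ℤ, (s = 1 ∨ s = -1) ∧ (t = 1 ∨ t = -1) ∧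
      y.1.1 = x.1.1 + (s : ZMod (2 * k)) ∧ y.1.2 = x.1.2 + (t : ZMod (2 * k)) := by
  have key : ∀ p q : ZMod (2 * k), (q - p = 1 ∨ q - p = -1) ∨ (p - q = 1 ∨ p - q = -1) →
      ∃ s : ℤ, (s = 1 ∨ s = -1) ∧ q = p + (s : ZMod (2 * k)) := by
    rintro p q ((h | h) | (h | h))
    · exact ⟨1, by simp, by push_cast; linear_combination h⟩
    · exact ⟨-1, by simp, by push_cast; linear_combination h⟩
    · exact ⟨-1, by simp, by push_cast; linear_combination -h⟩
    · exact ⟨1, by simp, by push_cast; linear_combination -h⟩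
  rw [rotatedTorus, SimpleGraph.fromRel_adj] at h
  obtain ⟨s, hs, hsx⟩ := key x.1.1 y.1.1 (h.2.imp And.left And.left)
  obtain ⟨t, ht, htx⟩ := key x.1.2 y.1.2 (h.2.imp And.right And.right)
  exact ⟨s, t, hs, ht, hsx, htx⟩

/-- The vertex `x` is reached from `u` by an integral displacement compatible with a walk of
length `n` which, unless `n = 0`, does not move straight in the diagonal direction `(s, t)`. -/
def IsOffDiagonal {k : ℕ} (u : TorusVert k) (s t : ℤ) (n : ℕ) (x : TorusVert k) : Prop :=
  ∃ a b : ℤ, x.1.1 = u.1.1 + (a : ZMod (2 * k)) ∧ x.1.2 = u.1.2 + (b : ZMod (2 * k)) ∧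
    |a| ≤ n ∧ |b| ≤ n ∧ Even (a - n) ∧ (n ≠ 0 → ¬ (a = s * n ∧ b = t * n))

lemma IsOffDiagonal.step {k : ℕ} {u w x y : TorusVert k} {s t : ℤ} {n : ℕ}
    (hs : s = 1 ∨ s = -1) (ht : t = 1 ∨ t = -1)
    (hw₁ : w.1.1 = u.1.1 + (s : ZMod (2 * k))) (hw₂ : w.1.2 = u.1.2 + (t : ZMod (2 * k)))
    (hx : IsOffDiagonal u s t n x) (hxy : ((rotatedTorus k).deleteEdges {s(u, w)}).Adj x y) :
    IsOffDiagonal u s t (n + 1) y := by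
  rw [SimpleGraph.deleteEdges_adj, Set.mem_singleton_iff] at hxy
  obtain ⟨hadj, hne⟩ := hxy
  obtain ⟨c, d, hc, hd, hy₁, hy₂⟩ := rotatedTorus_adj_exists_sign hadj
  obtain ⟨a, b, hx₁, hx₂, ha, hb, hpar, hdiag⟩ := hx
  rw [abs_le] at ha hb
  refine ⟨a + c, b + d, by rw [hy₁, hx₁]; push_cast; ring, by rw [hy₂, hx₂]; push_cast; ring,
    ?_, ?_, ?_, ?_⟩
  · rw [abs_le]; push_cast; omega
  · rw [abs_le]; push_cast; omega
  · rw [Int.even_iff] at hpar ⊢; push_cast; omega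
  · rintro - ⟨h₁, h₂⟩
    push_cast at h₁ h₂
    have hac : a = s * n ∧ c = s := by rcases hs with rfl | rfl <;> omega
    have hbd : b = t * n ∧ d = t := by rcases ht with rfl | rfl <;> omega
    by_cases hn : n = 0
    · subst hn
      obtain ⟨rfl, rfl⟩ := hac
      obtain ⟨rfl, rfl⟩ := hbd
      have hxu : x = u := Subtype.ext (Prod.ext (by simpa using hx₁) (by simpa using hx₂))
      subst hxu
      have hyw : y = w := Subtype.ext (Prod.ext (hy₁.trans hw₁.symm) (hy₂.trans hw₂.symm))
      exact hne (by rw [hyw])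
    · exact hdiag hn ⟨hac.1, hbd.1⟩

lemma IsOffDiagonal.walk {k : ℕ} {u w x y : TorusVert k} {s t : ℤ}
    (hs : s = 1 ∨ s = -1) (ht : t = 1 ∨ t = -1)
    (hw₁ : w.1.1 = u.1.1 + (s : ZMod (2 * k))) (hw₂ : w.1.2 = u.1.2 + (t : ZMod (2 * k)))
    (p : ((rotatedTorus k).deleteEdges {s(u, w)}).Walk x y) {n : ℕ}
    (hx : IsOffDiagonal u s t n x) : IsOffDiagonal u s t (n + p.length) y := by
  induction p generalizing n with
  | nil => simpa using hx
  | cons h p ih =>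
    have := ih (hx.step hs ht hw₁ hw₂ h)
    rwa [SimpleGraph.Walk.length_cons, add_comm p.length, ← add_assoc]

lemma eq_of_intCast_eq_of_abs_le {k n : ℕ} {s a : ℤ} (hs : s = 1 ∨ s = -1) (hk : 1 ≤ k)
    (hn : n ≤ k) (ha : |a| ≤ n)
    (h : (a : ZMod (2 * k)) = ((s * (k - 1) : ℤ) : ZMod (2 * k))) : a = s * (k - 1) := by
  rw [ZMod.intCast_eq_intCast_iff_dvd_sub] at h
  rw [abs_le] at ha
  have := Int.eq_zero_of_abs_lt_dvd h (by
    rw [abs_lt]; push_cast; rcases hs with rfl | rfl <;> constructor <;> omega)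
  omega

lemma le_ecc_deleteEdges_left {k : ℕ} (hk : 1 ≤ k) {u w : TorusVert k}
    (huw : (rotatedTorus k).Adj u w) :
    ((k : ℕ∞) + 1) ≤ ecc ((rotatedTorus k).deleteEdges {s(u, w)}) u := by
  obtain ⟨s, t, hs, ht, hw₁, hw₂⟩ := rotatedTorus_adj_exists_sign huw
  obtain ⟨v, hv⟩ : ∃ v, ∀ p : ((rotatedTorus k).deleteEdges {s(u, w)}).Walk u v,
      k + 1 ≤ p.length := by
    rcases hk.eq_or_lt with rfl | hk2
    · refine ⟨w, fun p => ?_⟩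
      by_contra! hp
      obtain hp | hp : p.length = 0 ∨ p.length = 1 := by omega
      · exact huw.ne (SimpleGraph.Walk.eq_of_length_eq_zero hp)
      · simpa using SimpleGraph.Walk.adj_of_length_eq_one hp
    · let v : TorusVert k := ⟨(u.1.1 + ((s * (k - 1) : ℤ) : ZMod (2 * k)),
        u.1.2 + ((t * (k - 1) : ℤ) : ZMod (2 * k))), by
          obtain ⟨r, hr⟩ := u.2
          obtain ⟨q, hq⟩ : Even (s + t) := by
            rcases hs with rfl | rfl <;> rcases ht with rfl | rfl <;> decide
          have hq' : (s : ZMod (2 * k)) + t = q + q := by exact_mod_cast congrArg _ hq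
          refine ⟨r + q * (k - 1), ?_⟩
          push_cast
          linear_combination hr + ((k : ZMod (2 * k)) - 1) * hq'⟩
      refine ⟨v, fun p => ?_⟩
      by_contra! hp
      have hu : IsOffDiagonal u s t 0 u := ⟨0, 0, by simp, by simp, by simp, by simp, by simp,
        by simp⟩
      obtain ⟨a, b, h₁, h₂, ha, hb, hpar, hdiag⟩ := hu.walk hs ht hw₁ hw₂ p
      rw [zero_add] at ha hb hpar hdiag
      have ha' := eq_of_intCast_eq_of_abs_le hs hk (by omega) ha (add_left_cancel h₁).symm
      have hb' := eq_of_intCast_eq_of_abs_le ht hk (by omega) hb (add_left_cancel h₂).symm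
      have hlen : (p.length : ℤ) = k - 1 := by
        rw [Int.even_iff] at hpar
        rw [abs_le] at ha
        rcases hs with rfl | rfl <;> omega
      exact hdiag (by omega) (by rw [hlen]; exact ⟨ha', hb'⟩)
  refine le_trans ?_ (le_iSup _ v)
  exact le_iInf fun p => by exact_mod_cast hv p

/-- deleting any edge `e = {u,w}` from the rotated torus `T_k`
makes the eccentricity of each of its two endpoints at least `k + 1`. -/
theorem rotatedTorus_deleteEdge_ecc (k : ℕ) (hk : 1 ≤ k)
    (u w : TorusVert k) (huw : (rotatedTorus k).Adj u w) :
    ((k : ℕ∞) + 1) ≤ ecc ((rotatedTorus k).deleteEdges {s(u, w)}) u ∧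
    ((k : ℕ∞) + 1) ≤ ecc ((rotatedTorus k).deleteEdges {s(u, w)}) w := by
  refine ⟨le_ecc_deleteEdges_left hk huw, ?_⟩
  rw [Sym2.eq_swap]
  exact le_ecc_deleteEdges_left hk huw.symm
end

section
/- For every integer k ≥ 1, every edge e = {u,w} of the rotated torus T_k, and every vertex v of T_k, the distance from v to the closest endpoint of e satisfies min{d_{T_k}(v,u), d_{T_k}(v,w)} ≤ k − 1. -/
open scoped ENNReal

/-- An integer step of `±1` in both coordinates moves a vertex by distance at most one. -/
theorem rotatedTorus_edist_le_one {k : ℕ} {x y : TorusVert k}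
    (h₁ : y.1.1 - x.1.1 = 1 ∨ y.1.1 - x.1.1 = -1)
    (h₂ : y.1.2 - x.1.2 = 1 ∨ y.1.2 - x.1.2 = -1) :
    (rotatedTorus k).edist x y ≤ 1 := by
  by_cases hxy : x = y
  · simp [hxy]
  · have hadj : (rotatedTorus k).Adj x y :=
      (SimpleGraph.fromRel_adj _ _ _).2 ⟨hxy, Or.inl ⟨h₁, h₂⟩⟩
    exact (SimpleGraph.edist_eq_one_iff_adj.2 hadj).le

/-- Lifting the coordinate differences to integers of equal parity and absolute value at most `n`
bounds the distance by `n`. -/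
theorem rotatedTorus_edist_le_s18 {k : ℕ} (n : ℕ) (x y : TorusVert k) (a b : ℤ)
    (ha : y.1.1 - x.1.1 = a) (hb : y.1.2 - x.1.2 = b) (han : |a| ≤ n) (hbn : |b| ≤ n)
    (hab : Even (a + b)) : (rotatedTorus k).edist x y ≤ n := by
  have hzero (x : TorusVert k) (h₁ : y.1.1 - x.1.1 = 0) (h₂ : y.1.2 - x.1.2 = 0) :
      (rotatedTorus k).edist x y = 0 :=
    SimpleGraph.edist_eq_zero_iff.2
      (Subtype.ext (Prod.ext (sub_eq_zero.1 h₁).symm (sub_eq_zero.1 h₂).symm))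
  induction n generalizing x a b with
  | zero =>
    obtain rfl : a = 0 := by simpa using han
    obtain rfl : b = 0 := by simpa using hbn
    exact (hzero x (by simpa using ha) (by simpa using hb)).le
  | succ n ih =>
    by_cases h0 : a = 0 ∧ b = 0
    · obtain ⟨rfl, rfl⟩ := h0
      rw [hzero x (by simpa using ha) (by simpa using hb)]
      exact zero_le
    rw [abs_le] at han hbn
    obtain ⟨c, hc⟩ := hab
    push_cast at han hbn
    obtain ⟨s, hs, hsn⟩ : ∃ s : ℤ, (s = 1 ∨ s = -1) ∧ |a - s| ≤ n := by
      rcases lt_or_ge 0 a with h | h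
      · exact ⟨1, Or.inl rfl, abs_le.2 (by omega)⟩
      · exact ⟨-1, Or.inr rfl, abs_le.2 (by omega)⟩
    obtain ⟨t, ht, htn⟩ : ∃ t : ℤ, (t = 1 ∨ t = -1) ∧ |b - t| ≤ n := by
      rcases lt_or_ge 0 b with h | h
      · exact ⟨1, Or.inl rfl, abs_le.2 (by omega)⟩
      · exact ⟨-1, Or.inr rfl, abs_le.2 (by omega)⟩
    have hst : Even (s + t) := by
      rcases hs with rfl | rfl <;> rcases ht with rfl | rfl <;> decide
    let z : TorusVert k := ⟨(x.1.1 + s, x.1.2 + t), by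
      have h := x.2.add (hst.map (Int.castRingHom (ZMod (2 * k))))
      have e : x.1.1 + s + (x.1.2 + t) =
          x.1.1 + x.1.2 + Int.castRingHom (ZMod (2 * k)) (s + t) := by
        simp only [eq_intCast, Int.cast_add]; ring
      exact e ▸ h⟩
    have hz₁ : z.1.1 = x.1.1 + s := rfl
    have hz₂ : z.1.2 = x.1.2 + t := rfl
    have hxz : (rotatedTorus k).edist x z ≤ 1 := by
      apply rotatedTorus_edist_le_one
      · rcases hs with rfl | rfl <;> simp [hz₁]
      · rcases ht with rfl | rfl <;> simp [hz₂]
    have hzy : (rotatedTorus k).edist z y ≤ n := by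
      have ha' : y.1.1 - z.1.1 = ((a - s : ℤ) : ZMod (2 * k)) := by
        rw [hz₁, Int.cast_sub, ← ha]; ring
      have hb' : y.1.2 - z.1.2 = ((b - t : ℤ) : ZMod (2 * k)) := by
        rw [hz₂, Int.cast_sub, ← hb]; ring
      refine ih z (a - s) (b - t) ha' hb' hsn htn ?_
      obtain ⟨d, hd⟩ := hst
      exact ⟨c - d, by omega⟩
    calc (rotatedTorus k).edist x y
        ≤ (rotatedTorus k).edist x z + (rotatedTorus k).edist z y := SimpleGraph.edist_triangle
      _ ≤ 1 + n := add_le_add hxz hzy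
      _ = ((n + 1 : ℕ) : ℕ∞) := by push_cast; ring

/-- Parity of an integer is detected by its residue modulo an even number. -/
theorem Int.even_of_even_cast_zmod {k : ℕ} {c : ℤ} (h : Even (c : ZMod (2 * k))) : Even c := by
  obtain ⟨r, hr⟩ := h
  obtain ⟨r, rfl⟩ := ZMod.intCast_surjective r
  rw [← Int.cast_add, ZMod.intCast_eq_intCast_iff_dvd_sub] at hr
  obtain ⟨m, hm⟩ := hr
  refine ⟨r - k * m, ?_⟩
  push_cast at hm
  linarith

/-- Every residue modulo `2 * k` has an integer representative in `[-k, k]`. -/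
theorem ZMod.exists_intCast_eq_abs_le {k : ℕ} (hk : 1 ≤ k) (z : ZMod (2 * k)) :
    ∃ a : ℤ, z = a ∧ |a| ≤ k := by
  have : NeZero (2 * k) := ⟨by omega⟩
  refine ⟨z.valMinAbs, (ZMod.coe_valMinAbs z).symm, ?_⟩
  have h := ZMod.natAbs_valMinAbs_le z
  rw [Int.abs_eq_natAbs]
  omega

/-- A unit step from an integer in `[-k, k]` congruent to `k` modulo `2` lands,
modulo `2 * k`, in `[-(k - 1), k - 1]`. -/
theorem ZMod.exists_intCast_eq_add_unit {k : ℕ} (hk : 1 ≤ k) {a s : ℤ} (ha : |a| ≤ k)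
    (hp : Even (a + k)) (hs : s = 1 ∨ s = -1) :
    ∃ c : ℤ, ((a + s : ℤ) : ZMod (2 * k)) = c ∧ |c| ≤ (k - 1 : ℕ) ∧ Even (c + k + 1) := by
  obtain ⟨p, hp⟩ := hp
  rw [abs_le] at ha
  obtain ⟨m, hm⟩ : ∃ m : ℤ, (m = 0 ∨ m = 1 ∨ m = -1) ∧ |a + s - 2 * k * m| ≤ (k - 1 : ℕ) := by
    by_cases h₁ : a + s ≤ k - 1
    · by_cases h₂ : -(k - 1 : ℤ) ≤ a + s
      · exact ⟨0, by simp, abs_le.2 (by omega)⟩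
      · exact ⟨-1, by simp, abs_le.2 (by omega)⟩
    · exact ⟨1, by simp, abs_le.2 (by omega)⟩
  refine ⟨a + s - 2 * k * m, ?_, hm.2, ?_⟩
  · have h : ((2 * k : ℕ) : ZMod (2 * k)) = 0 := ZMod.natCast_self _
    push_cast at h ⊢
    rw [h]; ring
  · rw [Int.even_iff]
    rcases hm.1 with rfl | rfl | rfl <;> omega

/-- in the rotated torus `T_k`, every vertex `v` is at distance
at most `k − 1` from the closest endpoint of any edge `{u,w}`. -/
theorem rotatedTorus_dist_to_edge (k : ℕ) (hk : 1 ≤ k)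
    (u w : TorusVert k) (huw : (rotatedTorus k).Adj u w) (v : TorusVert k) :
    min ((rotatedTorus k).edist v u) ((rotatedTorus k).edist v w) ≤
      ((k - 1 : ℕ) : ℕ∞) := by
  obtain ⟨a, ha, hak⟩ := ZMod.exists_intCast_eq_abs_le hk (u.1.1 - v.1.1)
  obtain ⟨b, hb, hbk⟩ := ZMod.exists_intCast_eq_abs_le hk (u.1.2 - v.1.2)
  have hab : Even (a + b) := by
    apply Int.even_of_even_cast_zmod (k := k)
    have h := u.2.sub v.2
    rwa [Int.cast_add, ← ha, ← hb, sub_add_sub_comm]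
  by_cases hsmall : |a| ≤ (k - 1 : ℕ) ∧ |b| ≤ (k - 1 : ℕ)
  · exact min_le_of_left_le (rotatedTorus_edist_le_s18 _ v u a b ha hb hsmall.1 hsmall.2 hab)
  have hpar : Even (a + k) ∧ Even (b + k) := by
    rw [Int.even_iff] at hab ⊢
    rw [Int.even_iff]
    simp only [abs_le] at hak hbk hsmall
    omega
  have hstep : ∀ x y : ZMod (2 * k), (y - x = 1 ∨ y - x = -1) ∨ (x - y = 1 ∨ x - y = -1) →
      ∃ s : ℤ, (s = 1 ∨ s = -1) ∧ y = x + s := by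
    rintro x y ((h | h) | (h | h))
    · exact ⟨1, by simp, by push_cast; linear_combination h⟩
    · exact ⟨-1, by simp, by push_cast; linear_combination h⟩
    · exact ⟨-1, by simp, by push_cast; linear_combination -h⟩
    · exact ⟨1, by simp, by push_cast; linear_combination -h⟩
  have hrel := ((SimpleGraph.fromRel_adj _ _ _).1 huw).2
  obtain ⟨s, hs, hws⟩ := hstep u.1.1 w.1.1 (hrel.imp And.left And.left)
  obtain ⟨t, ht, hwt⟩ := hstep u.1.2 w.1.2 (hrel.imp And.right And.right)
  obtain ⟨c, hc, hck, hcp⟩ := ZMod.exists_intCast_eq_add_unit hk hak hpar.1 hs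
  obtain ⟨d, hd, hdk, hdp⟩ := ZMod.exists_intCast_eq_add_unit hk hbk hpar.2 ht
  refine min_le_of_right_le (rotatedTorus_edist_le_s18 _ v w c d ?_ ?_ hck hdk ?_)
  · rw [hws, ← hc, Int.cast_add, ← ha]; ring
  · rw [hwt, ← hd, Int.cast_add, ← hb]; ring
  · rw [Int.even_iff] at *
    omega
end

section
/- For every real α > 0 and every integer l with l ≡ 1 (mod 3) and l > α + 6, there exist a connected simple graph H on n = 2l − 1 vertices and a finite sequence σ⁰, σ¹, …, σᵐ (m ≥ 1) of strategy profiles of the max-distance network creation game on H with parameter α such that σᵐ = σ⁰ and, for every 0 ≤ t < m, the profiles σ^{t+1} and σ^t differ only in the strategy of a single player v_t whose cost strictly decreases, i.e., C_{v_t}(σ^{t+1}) < C_{v_t}(σ^t). Consequently, the max-distance network creation game on H with parameter α admits no ordinal potential function: there is no function Φ from strategy profiles to ℝ such that Φ(σ') < Φ(σ) whenever σ' is obtained from σ by a single player unilaterally changing its strategy and strictly decreasing its own cost. -/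
open scoped ENNReal Classical

namespace NCG

/-- Breadth-first levels from `v` bound the eccentricity of `v` from above. -/
theorem ecc_le_of_level {G : SimpleGraph V} {v : V} (g : V → ℕ) {r : ℕ}
    (hg : ∀ x, x ≠ v → ∃ y, G.Adj x y ∧ g y < g x) (hr : ∀ x, g x ≤ r) :
    ecc G v ≤ r := by
  have key : ∀ k x, g x = k → G.edist v x ≤ k := by
    intro k
    induction k using Nat.strong_induction_on with
    | _ k ih =>
      intro x hx
      by_cases hxv : x = v
      · simp [hxv]
      · obtain ⟨y, hxy, hlt⟩ := hg x hxv
        calc G.edist v x ≤ G.edist v y + G.edist y x := SimpleGraph.edist_triangle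
          _ ≤ (g y : ℕ∞) + 1 := by
              gcongr
              · exact ih _ (hx ▸ hlt) y rfl
              · exact (SimpleGraph.edist_eq_one_iff_adj.2 hxy.symm).le
          _ ≤ k := by exact_mod_cast hx ▸ hlt
  exact iSup_le fun x => (key _ x rfl).trans (by exact_mod_cast hr x)

/-- A function vanishing at `v` and growing by at most one along edges bounds the eccentricity
of `v` from below. -/
theorem le_ecc_of_lipschitz {G : SimpleGraph V} {v : V} (g : V → ℕ) (hv : g v = 0)
    (hg : ∀ x y, G.Adj x y → g y ≤ g x + 1) (z : V) : (g z : ℕ∞) ≤ ecc G v := by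
  have key : ∀ x y (p : G.Walk x y), g y ≤ g x + p.length := by
    intro x y p
    induction p with
    | nil => simp
    | cons h _ ih =>
      have := hg _ _ h
      rw [SimpleGraph.Walk.length_cons]
      omega
  refine le_trans ?_ (le_iSup (fun u => G.edist v u) z)
  refine le_iInf fun p => ?_
  have := key _ _ p
  rw [hv, zero_add] at this
  exact_mod_cast this

/-- A cycle of improving moves rules out an ordinal potential function. -/
theorem no_potential_of_cycle (H : SimpleGraph V) (α : ℝ) {m : ℕ} {σ : ℕ → V → Finset V}
    (hm : 1 ≤ m) (hval : ∀ t ≤ m, Valid H (σ t)) (hcyc : σ m = σ 0)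
    (himp : ∀ t < m, ∃ v : V, (∀ u : V, u ≠ v → σ (t + 1) u = σ t u) ∧
      cost α (σ (t + 1)) v < cost α (σ t) v) :
    ¬ ∃ Φ : (V → Finset V) → ℝ, ∀ σ σ' : V → Finset V,
        Valid H σ → Valid H σ' →
        (∃ v : V, (∀ u : V, u ≠ v → σ' u = σ u) ∧ cost α σ' v < cost α σ v) →
        Φ σ' < Φ σ := by
  rintro ⟨Φ, hΦ⟩
  have key : ∀ t, 1 ≤ t → t ≤ m → Φ (σ t) < Φ (σ 0) := by
    intro t h1
    induction t, h1 using Nat.le_induction with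
    | base => exact fun h => hΦ _ _ (hval 0 (by omega)) (hval 1 h) (himp 0 h)
    | succ t _ ih =>
      exact fun h => (hΦ _ _ (hval t (by omega)) (hval (t + 1) h) (himp t h)).trans
        (ih (by omega))
  exact (hcyc ▸ key m hm le_rfl).false

/-- With equally many bought edges, a smaller eccentricity means a smaller cost. -/
theorem cost_lt_cost {α : ℝ} {σ σ' : V → Finset V} {v : V} (hcard : (σ' v).card = (σ v).card)
    {r r' : ℕ} (hσ : ecc (created σ) v = r) (hσ' : ecc (created σ') v = r') (hr : r' < r) :
    cost α σ' v < cost α σ v := by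
  rw [cost, cost, hcard, hσ, hσ']
  refine ENNReal.add_lt_add_left ?_ ?_
  · exact ENNReal.mul_ne_top ENNReal.ofReal_ne_top (ENNReal.natCast_ne_top _)
  · simpa using hr

/-- The fixed strategies on ten vertices, where players `5` and `8` buy nothing. -/
def fixedProfile : Fin 10 → Finset (Fin 10) :=
  ![{1, 2}, ∅, {3, 5}, {4}, ∅, ∅, {5}, {6, 8}, ∅, {8}]

/-- The strategies on ten vertices: player `5` buys the edge to `i`, player `8` the edge to `j`,
and all other strategies are fixed. -/
def coreProfile (i j a : Fin 10) : Finset (Fin 10) :=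
  if a = 5 then {i} else if a = 8 then {j} else fixedProfile a

/-- The projection collapsing all additional vertices to vertex `9`. -/
def toCore {p : ℕ} : Fin 10 ⊕ Fin p → Fin 10 :=
  Sum.elim id fun _ => 9

/-- The profile `coreProfile i j`, extended by `p` additional players imitating player `9`. -/
def profile (p : ℕ) (i j : Fin 10) (x : Fin 10 ⊕ Fin p) : Finset (Fin 10 ⊕ Fin p) :=
  (coreProfile i j (toCore x)).map Function.Embedding.inl

/-- `g` consists of the distances from `v` in the graph created by `coreProfile i j`, with
maximum `r`. -/
def IsLevel (i j v : Fin 10) (g : Fin 10 → ℕ) (r : ℕ) : Prop :=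
  g v = 0 ∧ (∀ a, g a ≤ r) ∧ (∃ a, g a = r) ∧
    (∀ a, ∀ b ∈ coreProfile i j a, b ≠ a ∧ g a ≤ g b + 1 ∧ g b ≤ g a + 1) ∧
    ∀ a, a ≠ v → ∃ b, g b < g a ∧
      (b ∈ coreProfile i j a ∨ a ≠ 9 ∧ a ∈ coreProfile i j b)

instance (i j v : Fin 10) (g : Fin 10 → ℕ) (r : ℕ) : Decidable (IsLevel i j v g r) := by
  unfold IsLevel
  infer_instance

theorem toCore_ne {p : ℕ} {a : Fin 10} {u : Fin 10 ⊕ Fin p} (ha : a ≠ 9)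
    (hu : u ≠ Sum.inl a) : toCore u ≠ a := by
  rcases u with b | b
  · exact fun h => hu (congrArg Sum.inl h)
  · exact ha.symm

theorem inl_mem_profile {p : ℕ} {i j a : Fin 10} {x : Fin 10 ⊕ Fin p} :
    Sum.inl a ∈ profile p i j x ↔ a ∈ coreProfile i j (toCore x) := by
  simp [profile]

theorem toCore_mem_of_mem_profile {p : ℕ} {i j : Fin 10} {x y : Fin 10 ⊕ Fin p}
    (h : y ∈ profile p i j x) : toCore y ∈ coreProfile i j (toCore x) := by
  obtain ⟨a, ha, rfl⟩ := Finset.mem_map.1 h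
  exact ha

theorem ecc_profile {p : ℕ} {i j v : Fin 10} {g : Fin 10 → ℕ} {r : ℕ} (hv : v ≠ 9)
    (h : IsLevel i j v g r) : ecc (created (profile p i j)) (Sum.inl v) = r := by
  obtain ⟨h0, hr, ⟨z, rfl⟩, hlip, hpred⟩ := h
  apply le_antisymm
  · refine ecc_le_of_level (g ∘ toCore) (fun x hx => ?_) fun x => hr _
    obtain ⟨b, hb, hmem⟩ := hpred _ (toCore_ne hv hx)
    refine ⟨Sum.inl b, ?_, hb⟩
    rw [created, SimpleGraph.fromRel_adj]
    refine ⟨?_, ?_⟩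
    · rintro rfl
      exact hb.false
    · rcases hmem with hmem | ⟨h9, hmem⟩
      · exact Or.inl (inl_mem_profile.2 hmem)
      · rcases x with a | a
        · exact Or.inr (inl_mem_profile.2 hmem)
        · exact absurd rfl h9
  · refine le_ecc_of_lipschitz (v := Sum.inl v) (g ∘ toCore) h0 (fun x y hxy => ?_) (Sum.inl z)
    rw [created, SimpleGraph.fromRel_adj] at hxy
    rcases hxy.2 with h | h
    · exact (hlip _ _ (toCore_mem_of_mem_profile h)).2.2
    · exact (hlip _ _ (toCore_mem_of_mem_profile h)).2.1

theorem valid_profile {p : ℕ} {i j : Fin 10} (hi : i ≠ 5) (hj : j ≠ 8) :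
    Valid ⊤ (profile p i j) := by
  have key : ∀ a, a ∉ fixedProfile a := by decide
  intro v w hw
  rw [SimpleGraph.top_adj]
  rintro rfl
  have h := toCore_mem_of_mem_profile hw
  unfold coreProfile at h
  split_ifs at h with h5 h8
  · exact hi ((Finset.mem_singleton.1 h).symm.trans h5)
  · exact hj ((Finset.mem_singleton.1 h).symm.trans h8)
  · exact key _ h

theorem profile_eq_of_ne_five {p : ℕ} {i i' j : Fin 10} {u : Fin 10 ⊕ Fin p}
    (hu : u ≠ Sum.inl 5) : profile p i' j u = profile p i j u := by
  simp only [profile, coreProfile, if_neg (toCore_ne (by decide) hu)]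

theorem profile_eq_of_ne_eight {p : ℕ} {i j j' : Fin 10} {u : Fin 10 ⊕ Fin p}
    (hu : u ≠ Sum.inl 8) : profile p i j' u = profile p i j u := by
  simp only [profile, coreProfile, if_neg (toCore_ne (by decide) hu)]

theorem improving_five {p : ℕ} {α : ℝ} {i i' j : Fin 10} {g g' : Fin 10 → ℕ} {r r' : ℕ}
    (h : IsLevel i j 5 g r) (h' : IsLevel i' j 5 g' r') (hr : r' < r) :
    ∃ v, (∀ u, u ≠ v → profile p i' j u = profile p i j u) ∧
      cost α (profile p i' j) v < cost α (profile p i j) v :=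
  ⟨Sum.inl 5, fun _ => profile_eq_of_ne_five,
    cost_lt_cost rfl (ecc_profile (by decide) h) (ecc_profile (by decide) h') hr⟩

theorem improving_eight {p : ℕ} {α : ℝ} {i j j' : Fin 10} {g g' : Fin 10 → ℕ} {r r' : ℕ}
    (h : IsLevel i j 8 g r) (h' : IsLevel i j' 8 g' r') (hr : r' < r) :
    ∃ v, (∀ u, u ≠ v → profile p i j' u = profile p i j u) ∧
      cost α (profile p i j') v < cost α (profile p i j) v :=
  ⟨Sum.inl 8, fun _ => profile_eq_of_ne_eight,
    cost_lt_cost rfl (ecc_profile (by decide) h) (ecc_profile (by decide) h') hr⟩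

/-- The cyclic sequence of four profiles: player `5` wants to buy the edge to the same vertex as
player `8`, and player `8` wants to avoid this. -/
def cycle (p t : ℕ) : Fin 10 ⊕ Fin p → Finset (Fin 10 ⊕ Fin p) :=
  match t with
  | 1 => profile p 4 4
  | 2 => profile p 4 1
  | 3 => profile p 1 1
  | _ => profile p 1 4

theorem valid_cycle (p t : ℕ) : Valid ⊤ (cycle p t) := by
  unfold cycle
  split <;> exact valid_profile (by decide) (by decide)

theorem improving_cycle (p : ℕ) (α : ℝ) (t : ℕ) (ht : t < 4) :
    ∃ v, (∀ u, u ≠ v → cycle p (t + 1) u = cycle p t u) ∧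
      cost α (cycle p (t + 1)) v < cost α (cycle p t) v := by
  interval_cases t
  · exact improving_five (g := ![2, 1, 1, 2, 3, 0, 1, 2, 3, 4]) (r := 4)
      (g' := ![2, 3, 1, 2, 1, 0, 1, 2, 2, 3]) (r' := 3) (by decide) (by decide) (by decide)
  · exact improving_eight (g := ![4, 5, 3, 2, 1, 2, 2, 1, 0, 1]) (r := 5)
      (g' := ![2, 1, 3, 4, 4, 3, 2, 1, 0, 1]) (r' := 4) (by decide) (by decide) (by decide)
  · exact improving_five (g := ![2, 3, 1, 2, 1, 0, 1, 2, 3, 4]) (r := 4)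
      (g' := ![2, 1, 1, 2, 3, 0, 1, 2, 2, 3]) (r' := 3) (by decide) (by decide) (by decide)
  · exact improving_eight (g := ![2, 1, 3, 4, 5, 2, 2, 1, 0, 1]) (r := 5)
      (g' := ![4, 4, 3, 2, 1, 3, 2, 1, 0, 1]) (r' := 4) (by decide) (by decide) (by decide)

end NCG

/-- for every `α > 0` and every `l ≡ 1 (mod 3)` with
`l > α + 6`, there is a connected host graph on `n = 2l − 1` vertices on which
the improving response dynamics can cycle; consequently the game admits no
ordinal potential function. -/
theorem not_potential_game (α : ℝ) (hα : 0 < α) (l : ℕ)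
    (hl3 : l % 3 = 1) (hl : α + 6 < (l : ℝ)) :
    ∃ (V : Type) (instF : Fintype V) (H : SimpleGraph V),
      H.Connected ∧ @Fintype.card V instF = 2 * l - 1 ∧
      (∃ (m : ℕ) (σ : ℕ → V → Finset V), 1 ≤ m ∧
        (∀ t ≤ m, NCG.Valid H (σ t)) ∧ σ m = σ 0 ∧
        (∀ t < m, ∃ v : V, (∀ u : V, u ≠ v → σ (t + 1) u = σ t u) ∧
          NCG.cost α (σ (t + 1)) v < NCG.cost α (σ t) v)) ∧
      ¬ ∃ Φ : (V → Finset V) → ℝ, ∀ σ σ' : V → Finset V,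
          NCG.Valid H σ → NCG.Valid H σ' →
          (∃ v : V, (∀ u : V, u ≠ v → σ' u = σ u) ∧
            NCG.cost α σ' v < NCG.cost α σ v) →
          Φ σ' < Φ σ := by
  have hl' : 6 < l := by exact_mod_cast (by linarith : (6 : ℝ) < l)
  refine ⟨Fin 10 ⊕ Fin (2 * l - 11), inferInstance, ⊤, SimpleGraph.connected_top, ?_,
    ⟨4, NCG.cycle _, by decide, fun t _ => NCG.valid_cycle _ t, rfl, NCG.improving_cycle _ α⟩,
    NCG.no_potential_of_cycle ⊤ α (m := 4) (by decide) (fun t _ => NCG.valid_cycle _ t) rfl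
      (NCG.improving_cycle _ α)⟩
  rw [Fintype.card_sum, Fintype.card_fin, Fintype.card_fin]
  omega
end
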